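/- arXiv:2307.03144 — 3 statements merged into one kernel-verified Lean document; each statement's English description precedes it below -/
import Mathlib

section
/- Let n be a nonzero integer, d a positive integer with d ∤ n, r₂ an even integer, and Q ∈ ℤ with Q ≠ −1 and r₂ + Q ≥ 0. For each c' with 0 < c' ≤ d and gcd(c',d) ∣ n, let ã_{c'} ∈ (0,1) be the fractional part of u_{c',d} (which is not an integer since d ∤ n), and let L_{c'} = −ζ_s'(−Q, ã_{c'}) − (−1)^Q·ζ_s'(−Q, 1−ã_{c'}), where ζ_s'(s₀,a) denotes the derivative in s of the Hurwitz zeta function ζ(s,a) evaluated at s = s₀. Then ∑_{0<c'≤d, gcd(c',d)∣n} gcd(c',d)^{−Q}·ζ(−(r₂+Q), c'/d)·L_{c'} = 0. -/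
open scoped BigOperators

/-- The divisor function `σ_ν(m) = ∑_{d ∣ |m|} d^ν` for `ν ∈ ℂ` and `m ∈ ℤ`. -/
noncomputable def dsigma (ν : ℂ) (m : ℤ) : ℂ := ∑ d ∈ m.natAbs.divisors, (d : ℂ) ^ ν

/-- The Hurwitz zeta function `ζ(s, a)`, meromorphically continued in `s`. -/
noncomputable def hzeta (s : ℂ) (a : ℝ) : ℂ := HurwitzZeta.hurwitzZeta (a : UnitAddCircle) s

/-- `b` is an element of `B_{c,d} = {b : ∃ a, a·d − b·c = n}` of minimal absolute value. -/
def IsMinAbsB (n : ℤ) (c d : ℕ) (b : ℤ) : Prop :=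
  (∃ a : ℤ, a * d - b * c = n) ∧ ∀ b' : ℤ, (∃ a : ℤ, a * d - b' * c = n) → |b| ≤ |b'|

/-- `u_{c,d} = b*·gcd(c,d)/d`, given the minimizing element `b` of `B_{c,d}`. -/
noncomputable def uval (c d : ℕ) (b : ℤ) : ℝ := ((b * Nat.gcd c d : ℤ) : ℝ) / (d : ℝ)

/-- The parity relation `ζ(−m, −x) = (−1)^{m+1} ζ(−m, x)` on the circle, for `x ≠ 0`. -/
lemma hurwitzZeta_neg_neg_nat {x : UnitAddCircle} (hx : x ≠ 0) (m : ℕ) :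
    HurwitzZeta.hurwitzZeta (-x) (-(m : ℂ)) =
      (-1) ^ (m + 1) * HurwitzZeta.hurwitzZeta x (-(m : ℂ)) := by
  unfold HurwitzZeta.hurwitzZeta
  rw [HurwitzZeta.hurwitzZetaEven_neg, HurwitzZeta.hurwitzZetaOdd_neg]
  rcases Nat.even_or_odd' m with ⟨k, rfl | rfl⟩
  · have heven : HurwitzZeta.hurwitzZetaEven x (-((2 * k : ℕ) : ℂ)) = 0 := by
      rcases k with _ | k
      · simp [HurwitzZeta.hurwitzZetaEven_apply_zero, hx]
      · simpa using HurwitzZeta.hurwitzZetaEven_neg_two_mul_nat_add_one x k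
    rw [heven, pow_succ, pow_mul]
    simp
  · have hodd : HurwitzZeta.hurwitzZetaOdd x (-((2 * k + 1 : ℕ) : ℂ)) = 0 := by
      rw [← HurwitzZeta.hurwitzZetaOdd_neg_two_mul_nat_sub_one x k]
      congr 1
      push_cast
      ring
    rw [hodd, show 2 * k + 1 + 1 = 2 * (k + 1) by ring, pow_mul]
    simp

/-- Any choices of `b` for `c` and for `d - c` give opposite values of `u` on the circle. -/
lemma coe_uval_sub {n : ℤ} {c d : ℕ} (hd : 0 < d) (hcd : c ≤ d) {b b' : ℤ}
    (hb : ∃ a : ℤ, a * d - b * c = n) (hb' : ∃ a : ℤ, a * d - b' * (d - c : ℕ) = n) :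
    (uval (d - c) d b' : UnitAddCircle) = -(uval c d b : UnitAddCircle) := by
  obtain ⟨a, ha⟩ := hb
  obtain ⟨a', ha'⟩ := hb'
  push_cast [hcd] at ha'
  have hdvd : (d : ℤ) ∣ (b' + b) * Nat.gcd c d := by
    rw [Nat.gcd_eq_gcd_ab]
    have hc : (d : ℤ) ∣ (b' + b) * c := ⟨a - a' + b', by linear_combination ha' - ha⟩
    obtain ⟨t, ht⟩ := hc
    exact ⟨t * Nat.gcdA c d + (b' + b) * Nat.gcdB c d, by linear_combination Nat.gcdA c d * ht⟩
  obtain ⟨t, ht⟩ := hdvd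
  have hd' : (d : ℝ) ≠ 0 := by positivity
  have ht' : ((b' : ℝ) + b) * Nat.gcd c d = d * t := by exact_mod_cast ht
  have hsum : uval (d - c) d b' = -uval c d b + t := by
    unfold uval
    rw [Nat.gcd_self_sub_left hcd]
    push_cast
    field_simp
    linear_combination ht'
  rw [hsum, AddCircle.coe_add, AddCircle.coe_neg, add_eq_left]
  exact (AddCircle.coe_eq_zero_iff 1).mpr ⟨t, by simp⟩

lemma coe_fract (x : ℝ) : ((Int.fract x : ℝ) : UnitAddCircle) = x := by
  rw [Int.fract, AddCircle.coe_sub, sub_eq_self]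
  exact (AddCircle.coe_eq_zero_iff 1).mpr ⟨⌊x⌋, by simp⟩

lemma coe_one_sub_fract (x : ℝ) :
    ((1 - Int.fract x : ℝ) : UnitAddCircle) = -(x : UnitAddCircle) := by
  rw [AddCircle.coe_sub, coe_fract, AddCircle.coe_period, zero_sub]

/-- Vanishing of the inner sum in the last term of the main logarithmic identity:
for `n ≠ 0`, `d ∤ n`, `r₂` even, `Q ≠ −1` with `r₂ + Q ≥ 0`,
`∑_{0<c'≤d, gcd(c',d)∣n} gcd(c',d)^{−Q}·ζ(−(r₂+Q), c'/d)·L_{c'} = 0`, where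
`L_{c'} = −ζ_s'(−Q, ã_{c'}) − (−1)^Q·ζ_s'(−Q, 1−ã_{c'})` and `ã_{c'}` is the fractional
part of `u_{c',d}`. -/
theorem inner_sum_vanishes_log (n : ℤ) (hn : n ≠ 0) (d : ℕ) (hd : 0 < d)
    (hdn : ¬ (d : ℤ) ∣ n) (r₂ : ℤ) (hr₂ : Even r₂) (Q : ℤ) (hQ : Q ≠ -1)
    (hrQ : 0 ≤ r₂ + Q)
    (bstar : ℕ → ℤ)
    (hb : ∀ c' ∈ Finset.Icc 1 d, (Nat.gcd c' d : ℤ) ∣ n → IsMinAbsB n c' d (bstar c')) :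
    ∑ c' ∈ Finset.Icc 1 d, (if (Nat.gcd c' d : ℤ) ∣ n then
      (Nat.gcd c' d : ℂ) ^ (-Q) * hzeta (-((r₂ : ℂ) + (Q : ℂ))) ((c' : ℝ) / d) *
        (- deriv (fun z : ℂ => hzeta z (Int.fract (uval c' d (bstar c')))) (-(Q : ℂ))
          - (-1 : ℂ) ^ Q *
            deriv (fun z : ℂ => hzeta z (1 - Int.fract (uval c' d (bstar c')))) (-(Q : ℂ)))
      else 0) = 0 := by
  rw [← Finset.Ico_insert_right (by omega : 1 ≤ d), Finset.sum_insert (by simp)]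
  rw [if_neg (by simpa using hdn), zero_add]
  simp only [hzeta, coe_fract, coe_one_sub_fract]
  obtain ⟨m, hm⟩ := Int.eq_ofNat_of_zero_le hrQ
  have hmC : (r₂ : ℂ) + Q = m := by exact_mod_cast hm
  have hsign : (-1 : ℂ) ^ Q = (-1) ^ m := by
    rw [← zpow_natCast, ← hm, zpow_add₀ (by norm_num), hr₂.neg_one_zpow, one_mul]
  have hsq : (-1 : ℂ) ^ m * (-1) ^ m = 1 := by rw [← mul_pow]; simp
  simp only [hmC, hsign]
  have hgcd : ∀ c ∈ Finset.Ico 1 d, Nat.gcd (d - c) d = Nat.gcd c d := fun c hc =>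
    Nat.gcd_self_sub_left (Finset.mem_Ico.mp hc).2.le
  have hreflect : ∀ c ∈ Finset.Ico 1 d, d - c ∈ Finset.Ico 1 d := fun c hc => by
    rw [Finset.mem_Ico] at hc ⊢
    omega
  rw [← self_eq_neg, ← Finset.sum_neg_distrib]
  refine Finset.sum_nbij' (d - ·) (d - ·) hreflect hreflect
    (fun c hc => Nat.sub_sub_self (Finset.mem_Ico.mp hc).2.le)
    (fun c hc => Nat.sub_sub_self (Finset.mem_Ico.mp hc).2.le) fun c hc => ?_
  rw [hgcd c hc]
  split_ifs with hdiv
  swap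
  · simp
  obtain ⟨hc1, hcd⟩ := Finset.mem_Ico.mp hc
  have hd' : (d : ℝ) ≠ 0 := by positivity
  have hu := coe_uval_sub hd hcd.le
    (hb c (Finset.mem_Icc.mpr ⟨hc1, hcd.le⟩) hdiv).1
    (hb (d - c) (Finset.mem_Icc.mpr (by omega)) (by rwa [hgcd c hc])).1
  have hx : (((c : ℝ) / d : ℝ) : UnitAddCircle) ≠ 0 := by
    have hpos : (0 : ℝ) < c / d := by positivity
    have hlt : (c : ℝ) / d < 1 := (div_lt_one (by positivity)).mpr (by exact_mod_cast hcd)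
    rw [Ne, AddCircle.coe_eq_zero_iff]
    rintro ⟨t, ht⟩
    rw [zsmul_one] at ht
    rw [← ht] at hpos hlt
    norm_cast at hpos hlt
    omega
  have hneg : ((((d - c : ℕ) : ℝ) / d : ℝ) : UnitAddCircle) =
      -(((c : ℝ) / d : ℝ) : UnitAddCircle) := by
    rw [Nat.cast_sub hcd.le, sub_div, div_self hd', AddCircle.coe_sub, AddCircle.coe_period,
      zero_sub]
  rw [hu, neg_neg, hneg, hurwitzZeta_neg_neg_nat hx, pow_succ]
  generalize (-1 : ℂ) ^ m = e at hsq ⊢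
  generalize deriv (𝕜 := ℂ) (F := ℂ) _ _ = D₁
  generalize deriv (𝕜 := ℂ) (F := ℂ) _ _ = D₂
  generalize HurwitzZeta.hurwitzZeta _ _ = Z
  generalize (Nat.gcd c d : ℂ) ^ (-Q) = G
  linear_combination (G * Z * D₁) * hsq
end

section
/- Let n be a nonzero integer, d a positive integer with d ∤ n, r₂ ∈ ℝ, and P ∈ ℤ with P ≤ −3 − |r₂|. Then the following sums converge absolutely and ∑_{c∈ℕ} c^{r₂} ∑_{a,b∈ℤ∖{0}, ad−bc=n} (bc)^P = (−1)^{P+1}·n^P·σ_{r₂}(n) + d^{r₂+2P} ∑_{0<c'≤d, gcd(c',d)∣n} gcd(c',d)^{−P}·ζ(−r₂−P, c'/d)·∑_{m∈ℤ} (m+u_{c',d})^P. -/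
open scoped BigOperators

theorem summable_int_add_zpow (u : ℝ) {P : ℤ} (hP : P ≤ -2) :
    Summable (fun m : ℤ => ((m : ℝ) + u) ^ P) := by
  have h := (Real.summable_one_div_int_add_rpow u (-P : ℤ)).mpr (by
    have : (1 : ℤ) < -P := by omega
    exact_mod_cast this)
  refine Summable.of_norm (h.congr fun m => ?_)
  rw [Real.rpow_intCast, zpow_neg, one_div, inv_inv, norm_zpow, Real.norm_eq_abs]

/-- The sum of `(bc)^P` over all integer solutions of `ad - bc = n`, given one solution
`(a₀, b₀)`. -/
theorem hasSum_solutions {n a₀ b₀ : ℤ} {c d : ℕ} (hc : 0 < c) (hd : 0 < d)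
    (h₀ : a₀ * d - b₀ * c = n) {P : ℤ} (hP : P ≤ -2) :
    HasSum (fun ab : ℤ × ℤ => if ab.1 * d - ab.2 * c = n then ((ab.2 * c : ℤ) : ℂ) ^ P else 0)
      ((c : ℂ) ^ P * (((d : ℂ) ^ P * (Nat.gcd c d : ℂ) ^ (-P)) *
        ((∑' m : ℤ, ((m : ℝ) + uval c d b₀) ^ P : ℝ) : ℂ))) := by
  obtain ⟨g, c₁, d₁, hg, hcop, hc₁, hd₁⟩ := Nat.exists_coprime' (m := c) (n := d)
    (Nat.gcd_pos_of_pos_left _ hc)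
  have hgcd : Nat.gcd c d = g := by
    rw [hc₁, hd₁, Nat.gcd_mul_right, hcop.gcd_eq_one, one_mul]
  have hd₁0 : 0 < d₁ := Nat.pos_of_ne_zero (by rintro rfl; simp at hd₁; omega)
  have hcop' : IsCoprime (d₁ : ℤ) (c₁ : ℤ) := (Nat.isCoprime_iff_coprime.mpr hcop).symm
  have hgz : (g : ℤ) ≠ 0 := by exact_mod_cast hg.ne'
  have hdz : (d₁ : ℤ) ≠ 0 := by exact_mod_cast hd₁0.ne'
  have hcz : (c : ℤ) = c₁ * g := by exact_mod_cast hc₁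
  have hdz' : (d : ℤ) = d₁ * g := by exact_mod_cast hd₁
  let φ : ℤ → ℤ × ℤ := fun m => (a₀ + c₁ * m, b₀ + d₁ * m)
  have hφ : Function.Injective φ := by
    intro x y hxy
    have h2 : b₀ + d₁ * x = b₀ + d₁ * y := congrArg Prod.snd hxy
    exact mul_left_cancel₀ hdz (add_left_cancel h2)
  have hsol (m : ℤ) : (φ m).1 * d - (φ m).2 * c = n := by
    rw [← h₀, hcz, hdz']; simp only [φ]; ring
  refine (hφ.hasSum_iff ?_).mp ?_
  · rintro ⟨a, b⟩ hab
    refine if_neg fun h => hab ?_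
    have key : (a - a₀) * d₁ = (b - b₀) * c₁ := by
      refine mul_right_cancel₀ hgz ?_
      have := h.trans h₀.symm
      simp only [hcz, hdz'] at this
      linear_combination this
    obtain ⟨m, hm⟩ : (d₁ : ℤ) ∣ b - b₀ :=
      hcop'.dvd_of_dvd_mul_right ⟨a - a₀, by rw [← key]; ring⟩
    refine ⟨m, Prod.ext ?_ ?_⟩
    · refine mul_right_cancel₀ hdz ?_
      simp only [φ]
      rw [hm] at key
      linear_combination -key
    · simp only [φ]
      linear_combination -hm
  · have hS := (summable_int_add_zpow (uval c d b₀) hP).hasSum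
    have hS' := ((Complex.hasSum_ofReal.mpr hS).mul_left
      ((d : ℂ) ^ P * (Nat.gcd c d : ℂ) ^ (-P))).mul_left ((c : ℂ) ^ P)
    refine hS'.congr_fun ?_
    intro m
    simp only [Function.comp, if_pos (hsol m)]
    have hgC : (g : ℂ) ≠ 0 := by exact_mod_cast hg.ne'
    have hdC : (d₁ : ℂ) ≠ 0 := by exact_mod_cast hd₁0.ne'
    rw [hgcd, zpow_neg, ← inv_zpow, Complex.ofReal_zpow, ← mul_zpow, ← mul_zpow, ← mul_zpow]
    congr 1
    simp only [uval, hgcd, φ]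
    rw [hd₁]
    push_cast
    field_simp
    ring

/-- The terms with `a = 0` among the solutions of `ad - bc = n`. -/
theorem hasSum_solutions_fst_zero (n : ℤ) {c : ℕ} (hc : 0 < c) (P : ℤ) :
    HasSum (fun ab : ℤ × ℤ => if ab.1 = 0 ∧ -(ab.2 * c) = n then ((ab.2 * c : ℤ) : ℂ) ^ P else 0)
      (if (c : ℤ) ∣ n then (-(n : ℂ)) ^ P else 0) := by
  have hcz : (c : ℤ) ≠ 0 := by exact_mod_cast hc.ne'
  split_ifs with h
  · obtain ⟨k, rfl⟩ := h
    convert hasSum_single (f := fun ab : ℤ × ℤ => if ab.1 = 0 ∧ -(ab.2 * c) = c * k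
      then ((ab.2 * c : ℤ) : ℂ) ^ P else 0) ((0 : ℤ), -k) ?_ using 1
    · rw [if_pos ⟨rfl, by ring⟩]
      push_cast; ring_nf
    · rintro ⟨a, b⟩ hab
      refine if_neg ?_
      rintro ⟨h1, h2⟩
      refine hab (Prod.ext h1 (mul_right_cancel₀ hcz ?_))
      simp only at h2 ⊢
      linear_combination -h2
  · convert hasSum_zero using 2 with ab
    refine if_neg ?_
    rintro ⟨-, h2⟩
    exact h ⟨-ab.2, by rw [← h2]; ring⟩

theorem hasSum_progression {c' d : ℕ} (hc' : c' ∈ Finset.Icc 1 d) {s : ℂ} (hs : s.re < -1) :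
    HasSum (fun c : ℕ => if 0 < c ∧ c ≡ c' [MOD d] then (c : ℂ) ^ s else 0)
      ((d : ℂ) ^ s * hzeta (-s) ((c' : ℝ) / d)) := by
  obtain ⟨h1, h2⟩ := Finset.mem_Icc.mp hc'
  have hd : 0 < d := by omega
  have hinj : Function.Injective (fun k : ℕ => c' + d * k) := fun x y hxy => by
    have : d * x = d * y := add_left_cancel hxy
    exact Nat.eq_of_mul_eq_mul_left hd this
  refine (hinj.hasSum_iff ?_).mp ?_
  · intro c hc
    refine if_neg fun ⟨h0, hmod⟩ => hc ?_
    have hle : c' ≤ c := by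
      by_contra! hlt
      have hdvd := (Nat.modEq_iff_dvd' hlt.le).mp hmod
      have := Nat.le_of_dvd (by omega) hdvd
      omega
    obtain ⟨k, hk⟩ := (Nat.modEq_iff_dvd' hle).mp hmod.symm
    exact ⟨k, by simp only; omega⟩
  · have hdR : (0 : ℝ) < d := by exact_mod_cast hd
    have hz := HurwitzZeta.hasSum_hurwitzZeta_of_one_lt_re (a := (c' : ℝ) / d) (s := -s)
      ⟨by positivity, (div_le_one hdR).mpr (by exact_mod_cast h2)⟩ (by simp; linarith)
    refine (hz.mul_left ((d : ℂ) ^ s)).congr_fun ?_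
    intro k
    have hm : 0 < c' + d * k ∧ c' + d * k ≡ c' [MOD d] :=
      ⟨by omega, by simp [Nat.ModEq]⟩
    simp only [Function.comp, if_pos hm]
    rw [Complex.cpow_neg, one_div, inv_inv]
    have e : ((k : ℂ) + (((c' : ℝ) / d : ℝ) : ℂ)) = ((k + (c' : ℝ) / d : ℝ) : ℂ) := by push_cast; rfl
    rw [e, ← Complex.ofReal_natCast d, ← Complex.mul_cpow_ofReal_nonneg hdR.le (by positivity),
      ← Complex.ofReal_mul]
    congr 1
    rw [mul_add, mul_div_cancel₀ _ hdR.ne']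
    push_cast
    ring

theorem hasSum_divisors {n : ℤ} (hn : n ≠ 0) (ν z : ℂ) :
    HasSum (fun c : ℕ => if 0 < c ∧ (c : ℤ) ∣ n then (c : ℂ) ^ ν * z else 0) (dsigma ν n * z) := by
  have h : dsigma ν n * z = ∑ c ∈ n.natAbs.divisors,
      (if 0 < c ∧ (c : ℤ) ∣ n then (c : ℂ) ^ ν * z else 0) := by
    rw [dsigma, Finset.sum_mul]
    refine Finset.sum_congr rfl fun c hc => ?_
    rw [if_pos ⟨Nat.pos_of_mem_divisors hc, Int.natCast_dvd.mpr (Nat.dvd_of_mem_divisors hc)⟩]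
  rw [h]
  refine hasSum_sum_of_ne_finset_zero fun c hc => if_neg fun ⟨_, h2⟩ => hc ?_
  exact Nat.mem_divisors.mpr ⟨Int.natCast_dvd.mp h2, by simpa using hn⟩

theorem exists_modEq_mem_Icc (c : ℕ) {d : ℕ} (hd : 0 < d) :
    ∃ c' ∈ Finset.Icc 1 d, c ≡ c' [MOD d] := by
  rcases Nat.eq_zero_or_pos (c % d) with h | h
  · exact ⟨d, Finset.mem_Icc.mpr ⟨hd, le_rfl⟩, by simpa [Nat.ModEq] using h⟩
  · exact ⟨c % d, Finset.mem_Icc.mpr ⟨h, (Nat.mod_lt _ hd).le⟩, (Nat.mod_modEq c d).symm⟩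

theorem eq_of_modEq_of_mem_Icc {x y d : ℕ} (hx : x ∈ Finset.Icc 1 d) (hy : y ∈ Finset.Icc 1 d)
    (h : x ≡ y [MOD d]) : x = y := by
  rw [Finset.mem_Icc] at hx hy
  rcases le_total x y with hxy | hxy
  · have := Nat.eq_zero_of_dvd_of_lt ((Nat.modEq_iff_dvd' hxy).mp h) (by omega)
    omega
  · have := Nat.eq_zero_of_dvd_of_lt ((Nat.modEq_iff_dvd' hxy).mp h.symm) (by omega)
    omega

/-- The weight attached to the residue class of `c'` modulo `d`. -/
noncomputable def residueWeight (n : ℤ) (d : ℕ) (P : ℤ) (bstar : ℕ → ℤ) (c' : ℕ) : ℂ :=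
  if (Nat.gcd c' d : ℤ) ∣ n then ((d : ℂ) ^ P * (Nat.gcd c' d : ℂ) ^ (-P)) *
    ((∑' m : ℤ, ((m : ℝ) + uval c' d (bstar c')) ^ P : ℝ) : ℂ) else 0

theorem hasSum_nonzero_solutions {n : ℤ} {c c' d : ℕ} (hc : 0 < c) (hd : 0 < d)
    (hdn : ¬ (d : ℤ) ∣ n) {P : ℤ} (hP : P ≤ -2) {bstar : ℕ → ℤ}
    (hmod : c ≡ c' [MOD d])
    (hb : (Nat.gcd c' d : ℤ) ∣ n → ∃ a : ℤ, a * d - bstar c' * c' = n) :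
    HasSum (fun ab : ℤ × ℤ => if ab.1 ≠ 0 ∧ ab.2 ≠ 0 ∧ ab.1 * d - ab.2 * c = n
        then ((ab.2 * c : ℤ) : ℂ) ^ P else 0)
      ((c : ℂ) ^ P * residueWeight n d P bstar c' -
        if (c : ℤ) ∣ n then (-(n : ℂ)) ^ P else 0) := by
  have hgcd : Nat.gcd c d = Nat.gcd c' d := hmod.gcd_eq
  have hall : HasSum (fun ab : ℤ × ℤ => if ab.1 * d - ab.2 * c = n
      then ((ab.2 * c : ℤ) : ℂ) ^ P else 0) ((c : ℂ) ^ P * residueWeight n d P bstar c') := by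
    unfold residueWeight
    split_ifs with h
    · obtain ⟨a, ha⟩ := hb h
      obtain ⟨k, hk⟩ := (Nat.modEq_iff_dvd.mp hmod)
      have := hasSum_solutions (a₀ := a - bstar c' * k) (b₀ := bstar c') (n := n) hc hd
        (by linear_combination ha + bstar c' * hk) hP
      rwa [show uval c d (bstar c') = uval c' d (bstar c') by simp only [uval, hgcd], hgcd] at this
    · rw [mul_zero]
      convert hasSum_zero using 2 with ab
      refine if_neg fun hab => h ?_
      rw [← hgcd, ← hab]
      exact dvd_sub (Dvd.dvd.mul_left (by exact_mod_cast Nat.gcd_dvd_right c d) _)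
        (Dvd.dvd.mul_left (by exact_mod_cast Nat.gcd_dvd_left c d) _)
  refine (hall.sub (hasSum_solutions_fst_zero n hc P)).congr_fun ?_
  rintro ⟨a, b⟩
  by_cases ha : a = 0
  · subst ha
    simp
  · by_cases hb0 : b = 0
    · subst hb0
      have : a * (d : ℤ) ≠ n := fun h => hdn ⟨a, by rw [← h]; ring⟩
      simp [ha, this]
    · simp [ha, hb0]


/-- Lemma 3.1 of the paper, case `d ∤ n`: for `n ≠ 0`, `d ∤ n`, `r₂ ∈ ℝ` and
`P ∈ ℤ` with `P ≤ −3−|r₂|`, the sums converge absolutely and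
`∑_{c∈ℕ} c^{r₂} ∑_{a,b∈ℤ∖{0}, ad−bc=n} (bc)^P
  = (−1)^{P+1}·n^P·σ_{r₂}(n)
    + d^{r₂+2P} ∑_{0<c'≤d, gcd(c',d)∣n} gcd(c',d)^{−P}·ζ(−r₂−P, c'/d)·∑_{m∈ℤ}(m+u_{c',d})^P`. -/
theorem shifted_sum_lemma_poly_not_dvd (n : ℤ) (hn : n ≠ 0) (d : ℕ) (hd : 0 < d)
    (hdn : ¬ (d : ℤ) ∣ n) (r₂ : ℝ) (P : ℤ) (hP : (P : ℝ) ≤ -3 - |r₂|)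
    (bstar : ℕ → ℤ)
    (hb : ∀ c' ∈ Finset.Icc 1 d, (Nat.gcd c' d : ℤ) ∣ n → IsMinAbsB n c' d (bstar c')) :
    (∀ c : ℕ, 0 < c → Summable (fun ab : ℤ × ℤ =>
        if ab.1 ≠ 0 ∧ ab.2 ≠ 0 ∧ ab.1 * d - ab.2 * c = n
          then ((ab.2 * c : ℤ) : ℂ) ^ P else 0)) ∧
    Summable (fun c : ℕ => if 0 < c then (c : ℂ) ^ (r₂ : ℂ) *
        ∑' ab : ℤ × ℤ, (if ab.1 ≠ 0 ∧ ab.2 ≠ 0 ∧ ab.1 * d - ab.2 * c = n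
          then ((ab.2 * c : ℤ) : ℂ) ^ P else 0) else 0) ∧
    (∀ c' ∈ Finset.Icc 1 d, (Nat.gcd c' d : ℤ) ∣ n →
      Summable (fun m : ℤ => ((m : ℝ) + uval c' d (bstar c')) ^ P)) ∧
    (∑' c : ℕ, if 0 < c then (c : ℂ) ^ (r₂ : ℂ) *
        ∑' ab : ℤ × ℤ, (if ab.1 ≠ 0 ∧ ab.2 ≠ 0 ∧ ab.1 * d - ab.2 * c = n
          then ((ab.2 * c : ℤ) : ℂ) ^ P else 0) else 0) =
      (-1 : ℂ) ^ (P + 1) * (n : ℂ) ^ P * dsigma (r₂ : ℂ) n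
      + (d : ℂ) ^ ((r₂ : ℂ) + 2 * (P : ℂ)) *
          ∑ c' ∈ Finset.Icc 1 d, (if (Nat.gcd c' d : ℤ) ∣ n then
            (Nat.gcd c' d : ℂ) ^ (-P) * hzeta (-(r₂ : ℂ) - (P : ℂ)) ((c' : ℝ) / d) *
              ((∑' m : ℤ, ((m : ℝ) + uval c' d (bstar c')) ^ P : ℝ) : ℂ) else 0) := by
  have hPR : (P : ℝ) ≤ -3 := by linarith [abs_nonneg r₂]
  have hP2 : P ≤ -2 := by
    have : P ≤ -3 := by exact_mod_cast hPR
    omega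
  have hdC : (d : ℂ) ≠ 0 := by exact_mod_cast hd.ne'
  have hb' (c' : ℕ) (hc' : c' ∈ Finset.Icc 1 d) (h : (Nat.gcd c' d : ℤ) ∣ n) :
      ∃ a : ℤ, a * d - bstar c' * c' = n := (hb c' hc' h).1
  have hs : ((r₂ : ℂ) + (P : ℂ)).re < -1 := by
    simp
    linarith [le_abs_self r₂]
  have hmain := (hasSum_sum fun c' (hc' : c' ∈ Finset.Icc 1 d) =>
    (hasSum_progression hc' hs).mul_right (residueWeight n d P bstar c')).sub (hasSum_divisors hn r₂ ((-(n : ℂ)) ^ P))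
  have houter := hmain.congr_fun (g := fun c : ℕ => if 0 < c then (c : ℂ) ^ (r₂ : ℂ) *
        ∑' ab : ℤ × ℤ, (if ab.1 ≠ 0 ∧ ab.2 ≠ 0 ∧ ab.1 * d - ab.2 * c = n
          then ((ab.2 * c : ℤ) : ℂ) ^ P else 0) else 0) (by
    intro c
    obtain rfl | hc := Nat.eq_zero_or_pos c
    · simp
    · obtain ⟨c', hc', hmod⟩ := exists_modEq_mem_Icc c hd
      have hcC : (c : ℂ) ≠ 0 := by exact_mod_cast hc.ne'
      rw [if_pos hc, (hasSum_nonzero_solutions hc hd hdn hP2 hmod (hb' c' hc')).tsum_eq,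
        Finset.sum_eq_single c' ?_ (fun h => absurd hc' h), if_pos (And.intro hc hmod),
        Complex.cpow_add _ _ hcC, Complex.cpow_intCast]
      · by_cases h : (c : ℤ) ∣ n <;> simp [h, hc] <;> ring
      · intro x hx hne
        rw [if_neg fun h => hne (eq_of_modEq_of_mem_Icc hx hc' (h.2.symm.trans hmod)), zero_mul])
  refine ⟨fun c hc => ?_, houter.summable, fun c' _ _ => summable_int_add_zpow _ hP2, ?_⟩
  · obtain ⟨c', hc', hmod⟩ := exists_modEq_mem_Icc c hd
    exact (hasSum_nonzero_solutions hc hd hdn hP2 hmod (hb' c' hc')).summable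
  · rw [houter.tsum_eq, sub_eq_neg_add, Finset.mul_sum]
    congr 1
    · rw [zpow_add_one₀ (by norm_num), neg_eq_neg_one_mul (n : ℂ), mul_zpow]
      ring
    · refine Finset.sum_congr rfl fun c' _ => ?_
      unfold residueWeight
      split_ifs
      · rw [two_mul, ← add_assoc, Complex.cpow_add ((r₂ : ℂ) + P) (P : ℂ) hdC,
          Complex.cpow_intCast, neg_add']
        ring
      · simp
end

section
/- Let n be a nonzero integer, d a positive integer with d ∣ n, r₂ ∈ ℝ, and Q ∈ ℤ with Q ≤ −3 − |r₂|. Then the following sums converge absolutely and ∑_{c∈ℕ} c^{r₂} ∑_{a,b∈ℤ∖{0}, ad−bc=n} (bc)^Q·log|bc| = (−1)^{Q+1}·σ_{r₂}(n)·n^Q·log|n| + 2·δ_{2∣Q}·d^Q·ζ(−Q)·∑_{c∈ℕ} c^{r₂+Q}·gcd(c,d)^{−Q}·(log c − log gcd(c,d)) + 2·δ_{2∣Q}·d^Q·(log(d)·ζ(−Q) − ζ'(−Q))·∑_{c∈ℕ} c^{r₂+Q}·gcd(c,d)^{−Q}. -/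
open scoped BigOperators

/-- The Dirichlet series of `ζ` at `-Q`, written with integer powers. -/
lemma hasSum_natCast_zpow {Q : ℤ} (hQ : Q < -1) :
    HasSum (fun k : ℕ => (k : ℂ) ^ Q) (riemannZeta (-(Q : ℂ))) := by
  have hre : 1 < (-(Q : ℂ)).re := by
    simp only [Complex.neg_re, Complex.intCast_re]
    exact_mod_cast (by omega : 1 < -Q)
  have h := (LSeriesSummable_one_iff.mpr hre).LSeriesHasSum
  rw [LSeries_one_eq_riemannZeta hre] at h
  refine HasSum.congr_fun h fun k => ?_
  rcases eq_or_ne k 0 with rfl | hk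
  · simp [zero_zpow Q (by omega)]
  · rw [LSeries.term_of_ne_zero hk, Complex.cpow_neg, Complex.cpow_intCast]
    simp

/-- The Dirichlet series of `-ζ'` at `-Q`, written with integer powers. -/
lemma hasSum_natCast_zpow_mul_log {Q : ℤ} (hQ : Q < -1) :
    HasSum (fun k : ℕ => (k : ℂ) ^ Q * (Real.log k : ℂ)) (-deriv riemannZeta (-(Q : ℂ))) := by
  have hre : 1 < (-(Q : ℂ)).re := by
    simp only [Complex.neg_re, Complex.intCast_re]
    exact_mod_cast (by omega : 1 < -Q)
  have habs : LSeries.abscissaOfAbsConv 1 < ((-(Q : ℂ)).re : EReal) := by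
    rw [LSeries.abscissaOfAbsConv_one]
    exact_mod_cast hre
  have h := (LSeriesSummable_logMul_of_lt_re habs).LSeriesHasSum
  have hderiv : deriv riemannZeta (-(Q : ℂ)) = deriv (LSeries 1) (-(Q : ℂ)) := by
    apply Filter.EventuallyEq.deriv_eq
    filter_upwards [(isOpen_lt continuous_const Complex.continuous_re).mem_nhds hre] with s hs
    exact (LSeries_one_eq_riemannZeta hs).symm
  rw [hderiv, LSeries_deriv habs, neg_neg]
  refine HasSum.congr_fun h fun k => ?_
  rcases eq_or_ne k 0 with rfl | hk
  · simp
  · rw [LSeries.term_of_ne_zero hk, Complex.cpow_neg, Complex.cpow_intCast]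
    simp [LSeries.logMul, Complex.natCast_log, mul_comm]

/-- The sum of `m^Q log|m|` over the multiples `m` of a positive integer `L`. -/
lemma hasSum_int_zpow_mul_log {Q : ℤ} (hQ : Q < -1) {L : ℕ} (hL : 0 < L) :
    HasSum (fun k : ℤ => ((k * L : ℤ) : ℂ) ^ Q * (Real.log |((k * L : ℤ) : ℝ)| : ℂ))
      (2 * (if 2 ∣ Q then (1 : ℂ) else 0) * ((L : ℂ) ^ Q *
        ((Real.log L : ℂ) * riemannZeta (-(Q : ℂ)) - deriv riemannZeta (-(Q : ℂ))))) := by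
  have hnat : HasSum (fun k : ℕ => (((k : ℤ) * L : ℤ) : ℂ) ^ Q *
      (Real.log |(((k : ℤ) * L : ℤ) : ℝ)| : ℂ)) ((L : ℂ) ^ Q *
        ((Real.log L : ℂ) * riemannZeta (-(Q : ℂ)) - deriv riemannZeta (-(Q : ℂ)))) := by
    have h := (((hasSum_natCast_zpow hQ).mul_left (Real.log L : ℂ)).add
      (hasSum_natCast_zpow_mul_log hQ)).mul_left ((L : ℂ) ^ Q)
    rw [← sub_eq_add_neg] at h
    refine HasSum.congr_fun h fun k => ?_
    rcases eq_or_ne k 0 with rfl | hk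
    · simp [zero_zpow Q (by omega)]
    · have hlog : Real.log |(((k : ℤ) * L : ℤ) : ℝ)| = Real.log k + Real.log L := by
        rw [Real.log_abs]
        push_cast
        exact Real.log_mul (by positivity) (by positivity)
      rw [hlog]
      push_cast
      rw [mul_zpow]
      ring
  have hneg : HasSum (fun k : ℕ => ((-(k : ℤ) * L : ℤ) : ℂ) ^ Q *
      (Real.log |((-(k : ℤ) * L : ℤ) : ℝ)| : ℂ)) ((-1) ^ Q * ((L : ℂ) ^ Q *
        ((Real.log L : ℂ) * riemannZeta (-(Q : ℂ)) - deriv riemannZeta (-(Q : ℂ))))) := by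
    refine HasSum.congr_fun (hnat.mul_left ((-1) ^ Q)) fun k => ?_
    rw [← mul_assoc, ← mul_zpow, neg_mul, Int.cast_neg, Int.cast_neg, abs_neg, neg_one_mul]
  have h := HasSum.of_nat_of_neg (f := fun k : ℤ => ((k * L : ℤ) : ℂ) ^ Q *
    (Real.log |((k * L : ℤ) : ℝ)| : ℂ)) hnat hneg
  refine (congrArg (HasSum _ · _) ?_).mp h
  split_ifs with h2
  · rw [(even_iff_two_dvd.mpr h2).neg_one_zpow]
    simp
    ring
  · rw [(Int.not_even_iff_odd.mp (mt even_iff_two_dvd.mp h2)).neg_one_zpow]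
    simp

/-- Evaluation of the inner sum over `a`, `b` for fixed `c`. -/
lemma hasSum_det_eq {n : ℤ} (hn : n ≠ 0) {c d : ℕ} (hc : 0 < c) (hd : 0 < d)
    (hdn : (d : ℤ) ∣ n) {Q : ℤ} (hQ : Q < -1) :
    HasSum (fun ab : ℤ × ℤ => if ab.1 ≠ 0 ∧ ab.2 ≠ 0 ∧ ab.1 * d - ab.2 * c = n
        then ((ab.2 * c : ℤ) : ℂ) ^ Q * (Real.log |((ab.2 * c : ℤ) : ℝ)| : ℂ) else 0)
      (2 * (if 2 ∣ Q then (1 : ℂ) else 0) * ((Nat.lcm c d : ℂ) ^ Q *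
        ((Real.log (Nat.lcm c d) : ℂ) * riemannZeta (-(Q : ℂ)) - deriv riemannZeta (-(Q : ℂ))))
        - if (c : ℤ) ∣ n then (-(n : ℂ)) ^ Q * (Real.log |(n : ℝ)| : ℂ) else 0) := by
  have hall : HasSum (fun ab : ℤ × ℤ => if ab.1 * d - ab.2 * c = n
        then ((ab.2 * c : ℤ) : ℂ) ^ Q * (Real.log |((ab.2 * c : ℤ) : ℝ)| : ℂ) else 0)
      (2 * (if 2 ∣ Q then (1 : ℂ) else 0) * ((Nat.lcm c d : ℂ) ^ Q *
        ((Real.log (Nat.lcm c d) : ℂ) * riemannZeta (-(Q : ℂ)) -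
          deriv riemannZeta (-(Q : ℂ))))) := by
    obtain ⟨n', rfl⟩ := hdn
    obtain ⟨c', hc'⟩ := Nat.dvd_lcm_left c d
    obtain ⟨d', hd'⟩ := Nat.dvd_lcm_right c d
    have hL : 0 < Nat.lcm c d := Nat.lcm_pos hc hd
    have hc_ne : (c' : ℤ) ≠ 0 := by
      intro h
      simp only [Nat.cast_eq_zero] at h
      simp [h] at hc'
      omega
    have hcz : (Nat.lcm c d : ℤ) = c * c' := by exact_mod_cast hc'
    have hdz : (Nat.lcm c d : ℤ) = d * d' := by exact_mod_cast hd'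
    have hinj : Function.Injective (fun k : ℤ => (n' + k * d', k * (c' : ℤ))) := by
      intro k l h
      exact mul_right_cancel₀ hc_ne (Prod.ext_iff.mp h).2
    refine (hinj.hasSum_iff ?_).mp (HasSum.congr_fun (hasSum_int_zpow_mul_log hQ hL) ?_)
    · rintro ⟨a, b⟩ hab
      refine if_neg fun h => hab ?_
      simp only at h
      have h1 : (Nat.lcm c d : ℤ) ∣ b * c :=
        Int.coe_lcm_dvd (a := c) (b := d) (dvd_mul_left _ _) ⟨a - n', by linear_combination -h⟩
      obtain ⟨k, hk⟩ := h1
      refine ⟨k, Prod.ext ?_ ?_⟩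
      · have : (d : ℤ) ≠ 0 := by positivity
        apply mul_right_cancel₀ this
        simp only
        linear_combination -h - hk - k * hdz
      · have : (c : ℤ) ≠ 0 := by positivity
        apply mul_right_cancel₀ this
        simp only
        linear_combination -hk - k * hcz
    · intro k
      have h1 : k * (c' : ℤ) * c = k * (Nat.lcm c d : ℤ) := by rw [hcz]; ring
      have h2 : (n' + k * d') * d - k * (c' : ℤ) * c = d * n' := by
        rw [h1, hdz]; ring
      simp only [Function.comp, h2, if_true]
      rw [h1]
  have hzero : HasSum (fun ab : ℤ × ℤ => if ab.1 = 0 ∧ ab.1 * d - ab.2 * c = n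
        then ((ab.2 * c : ℤ) : ℂ) ^ Q * (Real.log |((ab.2 * c : ℤ) : ℝ)| : ℂ) else 0)
      (if (c : ℤ) ∣ n then (-(n : ℂ)) ^ Q * (Real.log |(n : ℝ)| : ℂ) else 0) := by
    split_ifs with hcn
    · obtain ⟨m, rfl⟩ := hcn
      refine HasSum.congr_fun (hasSum_ite_eq ((0, -m) : ℤ × ℤ) _) ?_
      rintro ⟨a, b⟩
      have hiff : (a = 0 ∧ a * d - b * c = c * m) ↔ (a, b) = (0, -m) := by
        rw [Prod.mk.injEq]
        refine and_congr_right fun ha => ?_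
        subst ha
        have : (c : ℤ) ≠ 0 := by positivity
        constructor
        · intro h
          apply mul_right_cancel₀ this
          linear_combination -h
        · rintro rfl
          ring
      simp only [hiff]
      split_ifs with hab
      · rw [(Prod.mk.inj hab).2, neg_mul, mul_comm m, Int.cast_neg, Int.cast_neg, abs_neg]
      · rfl
    · refine HasSum.congr_fun hasSum_zero fun ab => if_neg ?_
      rintro ⟨ha, h⟩
      exact hcn ⟨-ab.2, by rw [← h, ha]; ring⟩
  refine HasSum.congr_fun (hall.sub hzero) fun ab => ?_
  by_cases h : ab.1 * d - ab.2 * c = n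
  · by_cases ha : ab.1 = 0
    · simp [ha]
    · by_cases hb : ab.2 = 0
      · simp [ha, hb]
      · simp [h, ha, hb]
  · simp [h]

lemma norm_cpow_mul_gcd_zpow_le {c d : ℕ} (hc : 0 < c) (hd : 0 < d) {r : ℝ} {Q : ℤ}
    (hQ : Q < 0) (hrQ : r + Q ≤ -3) :
    ‖(c : ℂ) ^ ((r : ℂ) + (Q : ℂ)) * (Nat.gcd c d : ℂ) ^ (-Q)‖ ≤
      (c : ℝ) ^ (-3 : ℝ) * (d : ℝ) ^ (-Q) := by
  rw [norm_mul, Complex.norm_natCast_cpow_of_pos hc, norm_zpow, Complex.norm_natCast]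
  have hc1 : (1 : ℝ) ≤ c := by exact_mod_cast hc
  have hg : (Nat.gcd c d : ℝ) ≤ d := by exact_mod_cast Nat.gcd_le_right c hd
  gcongr
  · simpa using hrQ
  · lift -Q to ℕ using by omega with q
    simp only [zpow_natCast]
    gcongr

lemma summable_cpow_mul_gcd_zpow {d : ℕ} (hd : 0 < d) {r : ℝ} {Q : ℤ}
    (hQ : Q < 0) (hrQ : r + Q ≤ -3) :
    Summable (fun c : ℕ => if 0 < c then (c : ℂ) ^ ((r : ℂ) + (Q : ℂ)) *
        (Nat.gcd c d : ℂ) ^ (-Q) else 0) := by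
  refine Summable.of_norm_bounded
    ((Real.summable_nat_rpow.mpr (by norm_num : (-3 : ℝ) < -1)).mul_right ((d : ℝ) ^ (-Q)))
    fun c => ?_
  split_ifs with hc
  · exact norm_cpow_mul_gcd_zpow_le hc hd hQ hrQ
  · rw [norm_zero]
    positivity

lemma summable_cpow_mul_gcd_zpow_mul_log {d : ℕ} (hd : 0 < d) {r : ℝ} {Q : ℤ}
    (hQ : Q < 0) (hrQ : r + Q ≤ -3) :
    Summable (fun c : ℕ => if 0 < c then (c : ℂ) ^ ((r : ℂ) + (Q : ℂ)) *
        (Nat.gcd c d : ℂ) ^ (-Q) *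
        ((Real.log c - Real.log (Nat.gcd c d) : ℝ) : ℂ) else 0) := by
  refine Summable.of_norm_bounded
    ((Real.summable_nat_rpow.mpr (by norm_num : (-2 : ℝ) < -1)).mul_right ((d : ℝ) ^ (-Q)))
    fun c => ?_
  split_ifs with hc
  · have hc0 : (0 : ℝ) < c := by exact_mod_cast hc
    have hg0 : 0 < Nat.gcd c d := Nat.gcd_pos_of_pos_left d hc
    have hg : (Nat.gcd c d : ℝ) ≤ c := by exact_mod_cast Nat.gcd_le_left d hc
    have hlog : ‖((Real.log c - Real.log (Nat.gcd c d) : ℝ) : ℂ)‖ ≤ c := by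
      have h1 := Real.log_le_log (by exact_mod_cast hg0) hg
      have h2 := Real.log_natCast_nonneg (Nat.gcd c d)
      have h3 := Real.log_le_self hc0.le
      rw [Complex.norm_real, Real.norm_eq_abs, abs_of_nonneg (by linarith)]
      linarith
    rw [norm_mul]
    calc _ ≤ (c : ℝ) ^ (-3 : ℝ) * (d : ℝ) ^ (-Q) * c := by
          gcongr
          exact norm_cpow_mul_gcd_zpow_le hc hd hQ hrQ
      _ = (c : ℝ) ^ (-2 : ℝ) * (d : ℝ) ^ (-Q) := by
          rw [show (-2 : ℝ) = -3 + 1 by norm_num, Real.rpow_add_one hc0.ne']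
          ring
  · rw [norm_zero]
    positivity

/-- The divisor sum `σ_ν(n)` as a series over all positive integers. -/
lemma hasSum_ite_dvd_cpow {n : ℤ} (hn : n ≠ 0) (ν : ℂ) :
    HasSum (fun c : ℕ => if (c : ℤ) ∣ n then (c : ℂ) ^ ν else 0) (dsigma ν n) := by
  have h : dsigma ν n = ∑ c ∈ n.natAbs.divisors, if (c : ℤ) ∣ n then (c : ℂ) ^ ν else 0 :=
    Finset.sum_congr rfl fun c hc =>
      (if_pos (Int.natCast_dvd.mpr (Nat.dvd_of_mem_divisors hc))).symm
  rw [h]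
  refine hasSum_sum_of_ne_finset_zero fun c hc => if_neg fun hcn => hc ?_
  exact Nat.mem_divisors.mpr ⟨Int.natCast_dvd.mp hcn, Int.natAbs_ne_zero.mpr hn⟩

/-- Lemma 3.3 of the paper, case `d ∣ n`: for `n ≠ 0`, `d ∣ n`, `r₂ ∈ ℝ` and
`Q ∈ ℤ` with `Q ≤ −3−|r₂|`, the sums converge absolutely and
`∑_{c∈ℕ} c^{r₂} ∑_{a,b∈ℤ∖{0}, ad−bc=n} (bc)^Q·log|bc|
  = (−1)^{Q+1}·σ_{r₂}(n)·n^Q·log|n|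
    + 2·δ_{2∣Q}·d^Q·ζ(−Q)·∑_{c∈ℕ} c^{r₂+Q}·gcd(c,d)^{−Q}·(log c − log gcd(c,d))
    + 2·δ_{2∣Q}·d^Q·(log(d)·ζ(−Q) − ζ'(−Q))·∑_{c∈ℕ} c^{r₂+Q}·gcd(c,d)^{−Q}`. -/
theorem shifted_sum_lemma_log_dvd (n : ℤ) (hn : n ≠ 0) (d : ℕ) (hd : 0 < d)
    (hdn : (d : ℤ) ∣ n) (r₂ : ℝ) (Q : ℤ) (hQ : (Q : ℝ) ≤ -3 - |r₂|) :
    (∀ c : ℕ, 0 < c → Summable (fun ab : ℤ × ℤ =>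
        if ab.1 ≠ 0 ∧ ab.2 ≠ 0 ∧ ab.1 * d - ab.2 * c = n
          then ((ab.2 * c : ℤ) : ℂ) ^ Q * (Real.log |((ab.2 * c : ℤ) : ℝ)| : ℂ) else 0)) ∧
    Summable (fun c : ℕ => if 0 < c then (c : ℂ) ^ (r₂ : ℂ) *
        ∑' ab : ℤ × ℤ, (if ab.1 ≠ 0 ∧ ab.2 ≠ 0 ∧ ab.1 * d - ab.2 * c = n
          then ((ab.2 * c : ℤ) : ℂ) ^ Q * (Real.log |((ab.2 * c : ℤ) : ℝ)| : ℂ) else 0)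
      else 0) ∧
    Summable (fun c : ℕ => if 0 < c then (c : ℂ) ^ ((r₂ : ℂ) + (Q : ℂ)) *
        (Nat.gcd c d : ℂ) ^ (-Q) *
        ((Real.log c - Real.log (Nat.gcd c d) : ℝ) : ℂ) else 0) ∧
    Summable (fun c : ℕ => if 0 < c then (c : ℂ) ^ ((r₂ : ℂ) + (Q : ℂ)) *
        (Nat.gcd c d : ℂ) ^ (-Q) else 0) ∧
    (∑' c : ℕ, if 0 < c then (c : ℂ) ^ (r₂ : ℂ) *
        ∑' ab : ℤ × ℤ, (if ab.1 ≠ 0 ∧ ab.2 ≠ 0 ∧ ab.1 * d - ab.2 * c = n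
          then ((ab.2 * c : ℤ) : ℂ) ^ Q * (Real.log |((ab.2 * c : ℤ) : ℝ)| : ℂ) else 0)
      else 0) =
      (-1 : ℂ) ^ (Q + 1) * dsigma (r₂ : ℂ) n * (n : ℂ) ^ Q * (Real.log |(n : ℝ)| : ℂ)
      + 2 * (if 2 ∣ Q then (1 : ℂ) else 0) * (d : ℂ) ^ Q * riemannZeta (-(Q : ℂ)) *
          (∑' c : ℕ, if 0 < c then (c : ℂ) ^ ((r₂ : ℂ) + (Q : ℂ)) *
            (Nat.gcd c d : ℂ) ^ (-Q) *
            ((Real.log c - Real.log (Nat.gcd c d) : ℝ) : ℂ) else 0)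
      + 2 * (if 2 ∣ Q then (1 : ℂ) else 0) * (d : ℂ) ^ Q *
          ((Real.log d : ℂ) * riemannZeta (-(Q : ℂ)) - deriv riemannZeta (-(Q : ℂ))) *
          (∑' c : ℕ, if 0 < c then (c : ℂ) ^ ((r₂ : ℂ) + (Q : ℂ)) *
            (Nat.gcd c d : ℂ) ^ (-Q) else 0) := by
  have hrQ : r₂ + Q ≤ -3 := by linarith [le_abs_self r₂]
  have hQ1 : Q < -1 := by
    have : (Q : ℝ) < -1 := by linarith [abs_nonneg r₂]
    exact_mod_cast this
  have hlog := summable_cpow_mul_gcd_zpow_mul_log hd (by omega) hrQ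
  have hgcd := summable_cpow_mul_gcd_zpow hd (by omega) hrQ
  have hmain := (((hasSum_ite_dvd_cpow hn (r₂ : ℂ)).mul_left
    ((-1 : ℂ) ^ (Q + 1) * (n : ℂ) ^ Q * (Real.log |(n : ℝ)| : ℂ))).add
    (hlog.hasSum.mul_left
      (2 * (if 2 ∣ Q then (1 : ℂ) else 0) * (d : ℂ) ^ Q * riemannZeta (-(Q : ℂ))))).add
    (hgcd.hasSum.mul_left (2 * (if 2 ∣ Q then (1 : ℂ) else 0) * (d : ℂ) ^ Q *
      ((Real.log d : ℂ) * riemannZeta (-(Q : ℂ)) - deriv riemannZeta (-(Q : ℂ)))))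
  have houter := hmain.congr_fun (g := fun c : ℕ => if 0 < c then (c : ℂ) ^ (r₂ : ℂ) *
      ∑' ab : ℤ × ℤ, (if ab.1 ≠ 0 ∧ ab.2 ≠ 0 ∧ ab.1 * d - ab.2 * c = n
        then ((ab.2 * c : ℤ) : ℂ) ^ Q * (Real.log |((ab.2 * c : ℤ) : ℝ)| : ℂ) else 0)
      else 0) fun c => by
    rcases Nat.eq_zero_or_pos c with rfl | hc
    · simp [hn]
    · have hc0 : (c : ℂ) ≠ 0 := by exact_mod_cast hc.ne'
      have hg0 : 0 < Nat.gcd c d := Nat.gcd_pos_of_pos_left d hc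
      have hgC : (Nat.gcd c d : ℂ) ≠ 0 := by exact_mod_cast hg0.ne'
      have hL0 : 0 < Nat.lcm c d := Nat.lcm_pos hc hd
      have hL : (Nat.lcm c d : ℂ) = c * d / Nat.gcd c d := by
        rw [eq_div_iff hgC, mul_comm]
        exact_mod_cast Nat.gcd_mul_lcm c d
      have hlogL : Real.log (Nat.lcm c d) =
          Real.log c + Real.log d - Real.log (Nat.gcd c d) := by
        rw [← Real.log_mul (by positivity) (by positivity), eq_sub_iff_add_eq,
          ← Real.log_mul (by positivity) (by positivity), mul_comm]
        congr 1
        exact_mod_cast Nat.gcd_mul_lcm c d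
      have hneg : (-(n : ℂ)) ^ Q = -((-1 : ℂ) ^ (Q + 1) * (n : ℂ) ^ Q) := by
        rw [← neg_one_mul (n : ℂ), mul_zpow, zpow_add_one₀ (by norm_num)]
        ring
      simp only [if_pos hc]
      rw [(hasSum_det_eq hn hc hd hdn hQ1).tsum_eq, hlogL, hL, div_zpow, mul_zpow,
        Complex.cpow_add _ _ hc0, Complex.cpow_intCast, zpow_neg, hneg]
      push_cast
      split_ifs <;> ring
  refine ⟨fun c hc => (hasSum_det_eq hn hc hd hdn hQ1).summable, houter.summable, hlog, hgcd, ?_⟩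
  rw [houter.tsum_eq]
  ring
end
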